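/- For α = 1/2 one has P( limsup_{t↑T} X^{(1/2)}_t / √(2(T−t) (ln(1/(T−t))) (ln ln ln(1/(T−t)))) = 1 ) = P( liminf_{t↑T} X^{(1/2)}_t / √(2(T−t) (ln(1/(T−t))) (ln ln ln(1/(T−t)))) = −1 ) = 1. In particular, P( limsup_{t↑T} X^{(1/2)}_t/√(T−t) = ∞ ) = P( liminf_{t↑T} X^{(1/2)}_t/√(T−t) = −∞ ) = 1. -/

import Mathlib

open MeasureTheory ProbabilityTheory Filter Set Topology
open scoped ENNReal NNReal

noncomputable section

variable {Ω : Type*} [MeasurableSpace Ω]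

/-- `B` is a standard 1-dimensional Wiener process on the probability space `(Ω, 𝒜, P)`:
it starts at `0`, has a.s. continuous paths, and its increments are independent of the past
and Gaussian with the correct variance. -/
structure IsStandardWiener (P : Measure Ω) (B : ℝ → Ω → ℝ) : Prop where
  meas : ∀ t : ℝ, Measurable (B t)
  init : ∀ᵐ ω ∂P, B 0 ω = 0
  cont : ∀ᵐ ω ∂P, Continuous fun t => B t ω
  incr_indep : ∀ s t : ℝ, 0 ≤ s → s ≤ t →
    IndepFun (fun ω => B t ω - B s ω) (fun ω (u : Set.Icc (0:ℝ) s) => B u.1 ω) P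
  incr_law : ∀ s t : ℝ, 0 ≤ s → s ≤ t →
    Measure.map (fun ω => B t ω - B s ω) P = gaussianReal 0 (Real.toNNReal (t - s))

/-- The `α`-Wiener bridge `X^{(α)}_t = ∫₀ᵗ ((T−t)/(T−s))^α dB_s`, `t ∈ [0,T)`, realized
pathwise through the integration-by-parts representation of the Wiener integral:
`X^{(α)}_t = B_t − α (T−t)^α ∫₀ᵗ (T−s)^{−α−1} B_s ds`. -/
def alphaWienerBridge (T α : ℝ) (B : ℝ → Ω → ℝ) (t : ℝ) (ω : Ω) : ℝ :=
  B t ω - α * (T - t) ^ α * ∫ s in Set.Ioc (0:ℝ) t, (T - s) ^ (-α - 1) * B s ω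

/-- `X` is independent of `m` with law `N(0, v)`, expressed through characteristic functions. -/
def IsGaussianStep (P : Measure Ω) (m : MeasurableSpace Ω) (X : Ω → ℝ) (v : ℝ) : Prop :=
  ∀ A : Set Ω, MeasurableSet[m] A → ∀ θ : ℝ,
    ∫ ω in A, Complex.exp (θ * X ω * Complex.I) ∂P =
      P.real A * Complex.exp (-((v * θ ^ 2 / 2 : ℝ) : ℂ))

namespace IsGaussianStep

variable {E : Type*} {m m' mE : MeasurableSpace E} {P : Measure E} {X Y : E → ℝ}
  {v w : ℝ}

lemma map_restrict [IsProbabilityMeasure P] (h : IsGaussianStep P m X v) (hv : 0 ≤ v) (hX : Measurable X) {A : Set E}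
    (hA : MeasurableSet[m] A) :
    (P.restrict A).map X = P A • gaussianReal 0 v.toNNReal := by
  have : IsFiniteMeasure (P A • gaussianReal 0 v.toNNReal) :=
    Measure.smul_finite _ (measure_ne_top _ _)
  apply Measure.ext_of_charFun
  ext θ
  have h2 : charFun (P A • gaussianReal 0 v.toNNReal) θ
      = P.real A * charFun (gaussianReal 0 v.toNNReal) θ := by
    simp only [charFun_apply_real, integral_smul_measure]
    simp [Measure.real]
  rw [h2, charFun_gaussianReal, charFun_apply_real, integral_map hX.aemeasurable (by fun_prop),
    h A hA θ]
  simp [Real.coe_toNNReal _ hv]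

lemma map_eq [IsProbabilityMeasure P] (h : IsGaussianStep P m X v) (hv : 0 ≤ v) (hX : Measurable X) :
    P.map X = gaussianReal 0 v.toNNReal := by
  simpa using h.map_restrict hv hX MeasurableSet.univ

lemma indep [IsProbabilityMeasure P] (h : IsGaussianStep P m X v) (hv : 0 ≤ v) (hX : Measurable X) :
    Indep (MeasurableSpace.comap X inferInstance) m P := by
  rw [Indep_iff]
  rintro _ A ⟨S, hS, rfl⟩ hA
  rw [← Measure.map_apply hX hS, h.map_eq hv hX, ← Measure.restrict_apply (hX hS),
    ← Measure.map_apply hX hS, h.map_restrict hv hX hA]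
  simp [mul_comm]

lemma of_indep (hX : Measurable X) (hv : 0 ≤ v)
    (h : Indep (MeasurableSpace.comap X inferInstance) m P)
    (hlaw : P.map X = gaussianReal 0 v.toNNReal) : IsGaussianStep P m X v := by
  intro A hA θ
  have key : (P.restrict A).map X = P A • gaussianReal 0 v.toNNReal := by
    ext S hS
    rw [Measure.map_apply hX hS, Measure.restrict_apply (hX hS), (Indep_iff _ _ _).1 h _ _
      ⟨S, hS, rfl⟩ hA, ← Measure.map_apply hX hS, hlaw]
    simp [mul_comm]
  have h1 : ∫ ω in A, Complex.exp (θ * X ω * Complex.I) ∂P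
      = ∫ x, Complex.exp (θ * x * Complex.I) ∂((P.restrict A).map X) := by
    rw [integral_map hX.aemeasurable (by fun_prop)]
  rw [h1, key, integral_smul_measure, ← charFun_apply_real, charFun_gaussianReal]
  simp [Real.coe_toNNReal _ hv, Measure.real]

lemma const_mul (h : IsGaussianStep P m X v) (c : ℝ) :
    IsGaussianStep P m (fun ω => c * X ω) (c ^ 2 * v) := by
  intro A hA θ
  have := h A hA (θ * c)
  push_cast at this ⊢
  simp_rw [← mul_assoc]
  rw [this]
  ring_nf

lemma add [IsProbabilityMeasure P] (h : IsGaussianStep P m X v) (h' : IsGaussianStep P m' Y w) (hw : 0 ≤ w)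
    (hmm : m ≤ m') (hm' : m' ≤ mE) (hX : Measurable[m'] X) (hY : Measurable Y) :
    IsGaussianStep P m (fun ω => X ω + Y ω) (v + w) := by
  intro A hA θ
  set U : E → ℂ := A.indicator (fun ω => Complex.exp (θ * X ω * Complex.I)) with hU
  set V : E → ℂ := fun ω => Complex.exp (θ * Y ω * Complex.I) with hV
  have hUm : Measurable[m'] U := by
    refine Measurable.indicator ?_ (hmm _ hA)
    have : Measurable (fun x : ℝ => Complex.exp (θ * x * Complex.I)) := by fun_prop
    exact this.comp hX
  have hind : IndepFun U V P := by
    rw [IndepFun_iff_Indep]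
    refine indep_of_indep_of_le_left (indep_of_indep_of_le_right (h'.indep hw hY).symm ?_) ?_
    · have : Measurable (fun x : ℝ => Complex.exp (θ * x * Complex.I)) := by fun_prop
      rintro _ ⟨S, hS, rfl⟩
      exact ⟨_, this hS, rfl⟩
    · exact hUm.comap_le
  have hVm : Measurable V := by fun_prop
  have := hind.integral_fun_mul_eq_mul_integral
    (hUm.mono hm' le_rfl).aestronglyMeasurable hVm.aestronglyMeasurable
  have hA' : MeasurableSet A := hm' _ (hmm _ hA)
  have e1 : ∫ ω in A, Complex.exp (θ * ((X ω + Y ω : ℝ) : ℂ) * Complex.I) ∂P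
      = ∫ ω, U ω * V ω ∂P := by
    rw [← integral_indicator hA']
    congr 1
    ext ω
    by_cases hω : ω ∈ A
    · simp only [hU, hV, indicator_of_mem hω, ← Complex.exp_add]
      push_cast
      ring_nf
    · simp [hU, hω]
  rw [e1, this, hU, integral_indicator hA', h A hA θ]
  have := h' Set.univ MeasurableSet.univ θ
  simp only [Measure.restrict_univ, probReal_univ] at this
  rw [hV, this, mul_assoc, Complex.ofReal_one, one_mul, ← Complex.exp_add]
  push_cast
  ring_nf

lemma zero : IsGaussianStep P m (fun _ => 0) 0 := by
  intro A hA θ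
  simp

lemma sum [IsProbabilityMeasure P] {F : ℕ → MeasurableSpace E} (hF : Monotone F) (hle : ∀ n, F n ≤ mE)
    {Z : ℕ → E → ℝ} (hZ : ∀ n, Measurable[F (n + 1)] (Z n)) {z : ℕ → ℝ} (hz : ∀ n, 0 ≤ z n)
    (h : ∀ n, IsGaussianStep P (F n) (Z n) (z n)) (n : ℕ) :
    IsGaussianStep P (F 0) (fun ω => ∑ k ∈ Finset.range n, Z k ω) (∑ k ∈ Finset.range n, z k) := by
  induction n with
  | zero => simpa using zero
  | succ n ih =>
    simp_rw [Finset.sum_range_succ]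
    refine ih.add (h n) (hz n) (hF (Nat.zero_le n)) (hle n) ?_ ((hZ n).mono (hle _) le_rfl)
    refine Finset.measurable_sum _ fun k hk => (hZ k).mono (hF ?_) le_rfl
    exact Finset.mem_range.1 hk

lemma of_tendsto [IsProbabilityMeasure P] {Z : ℕ → E → ℝ} {z : ℕ → ℝ} (hZ : ∀ n, Measurable (Z n))
    (h : ∀ n, IsGaussianStep P m (Z n) (z n))
    (hX : ∀ ω, Tendsto (fun n => Z n ω) atTop (𝓝 (X ω))) (hv : Tendsto z atTop (𝓝 v)) :
    IsGaussianStep P m X v := by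
  intro A hA θ
  have h1 : Tendsto (fun n => ∫ ω in A, Complex.exp (θ * Z n ω * Complex.I) ∂P) atTop
      (𝓝 (∫ ω in A, Complex.exp (θ * X ω * Complex.I) ∂P)) := by
    refine tendsto_integral_of_dominated_convergence (fun _ => 1) (fun n => ?_)
      (integrable_const _) (fun n => ae_of_all _ fun ω => ?_) (ae_of_all _ fun ω => ?_)
    · have := hZ n
      exact Measurable.aestronglyMeasurable (by fun_prop)
    · rw [← Complex.ofReal_mul, Complex.norm_exp_ofReal_mul_I]
    · have : Continuous (fun x : ℝ => Complex.exp (θ * x * Complex.I)) := by fun_prop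
      exact (this.tendsto _).comp (hX ω)
  refine tendsto_nhds_unique h1 ?_
  simp_rw [h _ A hA θ]
  have : Continuous (fun x : ℝ => (P.real A : ℂ) * Complex.exp (-((x * θ ^ 2 / 2 : ℝ) : ℂ))) := by
    fun_prop
  exact (this.tendsto _).comp hv

end IsGaussianStep

/-- A real process `W`, with continuous paths on `[0, ∞)` started at `0`, whose increments are
Gaussian with the variance of a Wiener process and independent of the filtration `G`. -/
structure IsFilteredWiener (P : Measure Ω) (G : ℝ → MeasurableSpace Ω) (W : ℝ → Ω → ℝ) :
    Prop where
  le : ∀ u, G u ≤ ‹MeasurableSpace Ω›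
  mono : Monotone G
  adapted : ∀ u, 0 ≤ u → Measurable[G u] (W u)
  step : ∀ u v, 0 ≤ u → u ≤ v → IsGaussianStep P (G u) (fun ω => W v ω - W u ω) (v - u)
  init : ∀ ω, W 0 ω = 0
  cont : ∀ ω, ContinuousOn (fun u => W u ω) (Ici 0)

lemma gaussianReal_Ici_zero (w : ℝ≥0) : 1 ≤ 2 * gaussianReal 0 w (Ici 0) := by
  have h : gaussianReal 0 w (Iic 0) = gaussianReal 0 w (Ici 0) := by
    conv_lhs => rw [← neg_zero, ← gaussianReal_map_neg, Measure.map_apply measurable_neg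
      measurableSet_Iic]
    congr 1
    ext x
    simp
  calc (1 : ℝ≥0∞) = gaussianReal 0 w (Iic 0 ∪ Ici 0) := by simp [Iic_union_Ici]
    _ ≤ gaussianReal 0 w (Iic 0) + gaussianReal 0 w (Ici 0) := measure_union_le _ _
    _ = 2 * gaussianReal 0 w (Ici 0) := by rw [h, two_mul]

namespace IsFilteredWiener

variable {P : Measure Ω} {G : ℝ → MeasurableSpace Ω} {W : ℝ → Ω → ℝ}

lemma measurable (h : IsFilteredWiener P G W) {u : ℝ} (hu : 0 ≤ u) : Measurable (W u) :=
  (h.adapted u hu).mono (h.le u) le_rfl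

lemma neg (h : IsFilteredWiener P G W) : IsFilteredWiener P G (fun u ω => - W u ω) where
  le := h.le
  mono := h.mono
  adapted u hu := (h.adapted u hu).neg
  step u v hu huv := by
    have := (h.step u v hu huv).const_mul (-1)
    simp only [neg_mul, one_mul, neg_sub] at this
    convert this using 2
    · ring
    · ring
  init ω := by simp [h.init]
  cont ω := (h.cont ω).neg

lemma map_sub [IsProbabilityMeasure P] (h : IsFilteredWiener P G W) {u v : ℝ} (hu : 0 ≤ u) (huv : u ≤ v) :
    P.map (fun ω => W v ω - W u ω) = gaussianReal 0 (v - u).toNNReal :=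
  (h.step u v hu huv).map_eq (sub_nonneg.2 huv)
    ((h.measurable (hu.trans huv)).sub (h.measurable hu))

lemma indep_sub [IsProbabilityMeasure P] (h : IsFilteredWiener P G W) {u v : ℝ} (hu : 0 ≤ u) (huv : u ≤ v) :
    Indep (MeasurableSpace.comap (fun ω => W v ω - W u ω) inferInstance) (G u) P :=
  (h.step u v hu huv).indep (sub_nonneg.2 huv)
    ((h.measurable (hu.trans huv)).sub (h.measurable hu))

lemma measure_gt_le [IsProbabilityMeasure P] (h : IsFilteredWiener P G W) {t x : ℝ} (ht : 0 < t) (hx : 0 ≤ x) :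
    P {ω | x < W t ω} ≤ ENNReal.ofReal (Real.exp (-x ^ 2 / (2 * t))) := by
  have hlaw : P.map (W t) = gaussianReal 0 t.toNNReal := by
    have := h.map_sub le_rfl ht.le
    simpa [h.init] using this
  have hX := h.measurable ht.le
  have hintegrable : Integrable (fun ω => Real.exp (x / t * W t ω)) P := by
    have := integrable_exp_mul_gaussianReal (μ := 0) (v := t.toNNReal) (x / t)
    rw [← hlaw] at this
    exact this.comp_measurable hX
  have := measure_ge_le_exp_mul_mgf (μ := P) (X := W t) x (t := x / t) (by positivity) hintegrable
  rw [mgf_gaussianReal hlaw, ← Real.exp_add] at this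
  calc
    _ ≤ P {ω | x ≤ W t ω} := by
      refine measure_mono fun ω hω => ?_
      rw [mem_ofPred_eq] at hω ⊢
      exact hω.le
    _ = ENNReal.ofReal (P.real {ω | x ≤ W t ω}) := by simp
    _ ≤ _ := by
      refine ENNReal.ofReal_le_ofReal (this.trans (Real.exp_le_exp.2 (le_of_eq ?_)))
      rw [Real.coe_toNNReal _ ht.le]
      field_simp
      ring

/-- Lévy's maximal inequality along a finite set of times. -/
lemma measure_exists_le_gt_le [IsProbabilityMeasure P] (h : IsFilteredWiener P G W) {s : ℕ → ℝ} (hs : Monotone s)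
    (hs0 : 0 ≤ s 0) {n : ℕ} {t : ℝ} (hst : s n ≤ t) (x : ℝ) :
    P {ω | ∃ k ≤ n, x < W (s k) ω} ≤ 2 * P {ω | x < W t ω} := by
  have hsk : ∀ k, 0 ≤ s k := fun k => hs0.trans (hs (Nat.zero_le k))
  set A : ℕ → Set Ω := fun k => {ω | x < W (s k) ω} \ ⋃ j ∈ Finset.range k, {ω | x < W (s j) ω}
    with hAdef
  have hS : ∀ j k, j ≤ k → MeasurableSet[G (s k)] {ω | x < W (s j) ω} := fun j k hjk =>
    h.mono (hs hjk) _ (h.adapted _ (hsk j) measurableSet_Ioi)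
  have hA : ∀ k, MeasurableSet[G (s k)] (A k) := fun k => by
    refine (hS k k le_rfl).diff (Finset.measurableSet_biUnion _ fun j hj => hS j k ?_)
    exact (Finset.mem_range.1 hj).le
  set C : ℕ → Set Ω := fun k => {ω | 0 ≤ W t ω - W (s k) ω}
  have hm : ∀ k, s k ≤ t → Measurable (fun ω => W t ω - W (s k) ω) := fun k hkt =>
    (h.measurable ((hsk k).trans hkt)).sub (h.measurable (hsk k))
  have hdisj : Pairwise (Function.onFun Disjoint A) := by
    have key : ∀ i j, i < j → Disjoint (A i) (A j) := fun i j hij => by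
      rw [Set.disjoint_left]
      rintro ω ⟨h1, -⟩ ⟨-, h2⟩
      exact h2 (mem_biUnion (Finset.mem_coe.2 (Finset.mem_range.2 hij)) h1)
    intro i j hij
    rcases lt_or_gt_of_ne hij with h' | h'
    exacts [key i j h', (key j i h').symm]
  have hcov : {ω | ∃ k ≤ n, x < W (s k) ω} ⊆ ⋃ k ∈ Finset.range (n + 1), A k := by
    classical
    rintro ω ⟨k, hk, hω⟩
    have hex : ∃ k, x < W (s k) ω := ⟨k, hω⟩
    simp only [mem_iUnion, Finset.mem_range, hAdef, Set.mem_sdiff, mem_ofPred_eq, not_exists]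
    exact ⟨Nat.find hex, Nat.lt_succ_of_le ((Nat.find_min' hex hω).trans hk), Nat.find_spec hex,
      fun j hj => Nat.find_min hex hj⟩
  have hstep : ∀ k ∈ Finset.range (n + 1), P (A k) ≤ 2 * P (A k ∩ C k) := fun k hk => by
    have hkt : s k ≤ t := (hs (Nat.lt_succ_iff.1 (Finset.mem_range.1 hk))).trans hst
    have h1 := (Indep_iff _ _ _).1 (h.indep_sub (hsk k) hkt) (C k) (A k)
      ⟨Ici 0, measurableSet_Ici, rfl⟩ (hA k)
    have h2 : P (C k) = gaussianReal 0 (t - s k).toNNReal (Ici 0) := by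
      rw [← h.map_sub (hsk k) hkt, Measure.map_apply (hm k hkt) measurableSet_Ici]
      rfl
    rw [inter_comm, h1, h2, ← mul_assoc]
    exact le_mul_of_one_le_left zero_le (gaussianReal_Ici_zero _)
  calc P {ω | ∃ k ≤ n, x < W (s k) ω} ≤ P (⋃ k ∈ Finset.range (n + 1), A k) := measure_mono hcov
    _ ≤ ∑ k ∈ Finset.range (n + 1), P (A k) := measure_biUnion_finset_le _ _
    _ ≤ ∑ k ∈ Finset.range (n + 1), 2 * P (A k ∩ C k) := Finset.sum_le_sum hstep
    _ = 2 * P (⋃ k ∈ Finset.range (n + 1), A k ∩ C k) := by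
      rw [← Finset.mul_sum, measure_biUnion_finset]
      · intro i _ j _ hij
        exact (hdisj hij).mono inter_subset_left inter_subset_left
      · intro k hk
        have hkt : s k ≤ t := (hs (Nat.lt_succ_iff.1 (Finset.mem_range.1 hk))).trans hst
        exact (h.le _ _ (hA k)).inter (measurableSet_le measurable_const (hm k hkt))
    _ ≤ 2 * P {ω | x < W t ω} := by
      gcongr
      simp only [iUnion_subset_iff]
      rintro k - ω ⟨⟨h1, -⟩, h2⟩
      simp only [mem_ofPred_eq, C] at h1 h2 ⊢
      linarith

lemma measure_exists_gt_le [IsProbabilityMeasure P] (h : IsFilteredWiener P G W) {t x : ℝ} (ht : 0 < t) (hx : 0 ≤ x) :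
    P {ω | ∃ u ∈ Icc 0 t, x < W u ω} ≤ 2 * ENNReal.ofReal (Real.exp (-x ^ 2 / (2 * t))) := by
  set E : ℕ → Set Ω := fun m => {ω | ∃ k : ℕ, k ≤ 2 ^ m ∧ x < W (t * (k / 2 ^ m)) ω}
  have hmono : Monotone E := by
    refine monotone_nat_of_le_succ fun m ω => ?_
    rintro ⟨k, hk, hω⟩
    refine ⟨2 * k, by rw [pow_succ]; omega, ?_⟩
    convert hω using 3
    push_cast
    field_simp
    ring
  have hcov : {ω | ∃ u ∈ Icc 0 t, x < W u ω} ⊆ ⋃ m, E m := by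
    rintro ω ⟨u, ⟨hu0, hut⟩, hω⟩
    have hpow : Tendsto (fun m : ℕ => (2 : ℝ) ^ m) atTop atTop :=
      tendsto_pow_atTop_atTop_of_one_lt one_lt_two
    have h1 : Tendsto (fun m : ℕ => t * ((⌊u / t * 2 ^ m⌋₊ : ℝ) / 2 ^ m)) atTop (𝓝 u) := by
      have := ((tendsto_nat_floor_mul_div_atTop (div_nonneg hu0 ht.le)).comp hpow).const_mul t
      rwa [mul_div_cancel₀ u ht.ne'] at this
    have h2 : Tendsto (fun m : ℕ => t * ((⌊u / t * 2 ^ m⌋₊ : ℝ) / 2 ^ m)) atTop (𝓝[Ici 0] u) :=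
      tendsto_nhdsWithin_iff.2 ⟨h1, Eventually.of_forall fun m => mem_Ici.2 (by positivity)⟩
    obtain ⟨m, hm⟩ := (((h.cont ω u hu0).tendsto.comp h2).eventually_const_lt hω).exists
    refine mem_iUnion.2 ⟨m, ⌊u / t * 2 ^ m⌋₊, ?_, hm⟩
    have : u / t * 2 ^ m ≤ ((2 ^ m : ℕ) : ℝ) := by
      push_cast
      exact mul_le_of_le_one_left (by positivity) ((div_le_one ht).2 hut)
    exact (Nat.floor_le_floor this).trans (Nat.floor_natCast _).le
  refine (measure_mono hcov).trans ?_
  rw [hmono.measure_iUnion]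
  refine iSup_le fun m => ?_
  refine (h.measure_exists_le_gt_le (s := fun k : ℕ => t * (k / 2 ^ m)) (n := 2 ^ m) (t := t)
    ?_ (by simp) ?_ x).trans ?_
  · intro i j hij
    have : (i : ℝ) ≤ j := by exact_mod_cast hij
    dsimp only
    gcongr
  · simp
  · gcongr
    exact h.measure_gt_le ht hx

end IsFilteredWiener

lemma iIndepSet_of_indep_filtration {E : Type*} [mE : MeasurableSpace E] {P : Measure E}
    [IsProbabilityMeasure P] {F : ℕ → MeasurableSpace E} (hF : Monotone F) (hle : ∀ n, F n ≤ mE)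
    {S : ℕ → Set E} (hS : ∀ n, MeasurableSet[F (n + 1)] (S n))
    (hind : ∀ n A, MeasurableSet[F n] A → P (S n ∩ A) = P (S n) * P A) : iIndepSet S P := by
  rw [iIndepSet_iff_meas_biInter fun n => hle _ _ (hS n)]
  intro s
  induction s using Finset.induction_on_max with
  | empty => simp
  | insert a s ha ih =>
    have has : a ∉ s := fun h => lt_irrefl _ (ha a h)
    rw [Finset.set_biInter_insert, Finset.prod_insert has, hind, ih]
    exact Finset.measurableSet_biInter _ fun i hi => hF (ha i hi) _ (hS i)

lemma le_gaussianReal_Ici {v : ℝ} (hv : 0 < v) {x : ℝ} (hx : 0 ≤ x) :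
    ENNReal.ofReal ((√(2 * Real.pi))⁻¹ * Real.exp (-(x + 1) ^ 2 / 2)) ≤
      gaussianReal 0 v.toNNReal (Ici (x * √v)) := by
  have hv' : v.toNNReal ≠ 0 := by simpa using hv
  have hs : 0 < √v := Real.sqrt_pos.2 hv
  rw [gaussianReal_apply _ hv']
  calc ENNReal.ofReal ((√(2 * Real.pi))⁻¹ * Real.exp (-(x + 1) ^ 2 / 2))
      = ENNReal.ofReal ((√(2 * Real.pi * v))⁻¹ * Real.exp (-(x + 1) ^ 2 / 2)) *
          volume (Icc (x * √v) ((x + 1) * √v)) := by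
        rw [Real.volume_Icc, ← ENNReal.ofReal_mul (by positivity)]
        congr 1
        rw [Real.sqrt_mul (x := 2 * Real.pi) (by positivity)]
        field_simp
        ring
    _ ≤ ∫⁻ y in Icc (x * √v) ((x + 1) * √v), gaussianPDF 0 v.toNNReal y := by
        rw [← setLIntegral_const]
        refine setLIntegral_mono (by fun_prop) fun y hy => ?_
        refine ENNReal.ofReal_le_ofReal ?_
        rw [gaussianPDFReal, Real.coe_toNNReal _ hv.le]
        refine mul_le_mul_of_nonneg_left (Real.exp_le_exp.2 ?_) (by positivity)
        rw [neg_div, neg_div, neg_le_neg_iff, sub_zero, div_le_div_iff₀ (by positivity) two_pos]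
        have : y ^ 2 ≤ ((x + 1) * √v) ^ 2 :=
          pow_le_pow_left₀ (le_trans (by positivity) hy.1) hy.2 2
        rw [mul_pow, Real.sq_sqrt hv.le] at this
        linarith
    _ ≤ ∫⁻ y in Ici (x * √v), gaussianPDF 0 v.toNNReal y :=
        lintegral_mono_set Icc_subset_Ici_self

/-- The normalizing function `√(2 u ln ln u)` of the law of the iterated logarithm. -/
def lilScale (u : ℝ) : ℝ := √(2 * u * Real.log (Real.log u))

lemma lilScale_nonneg (u : ℝ) : 0 ≤ lilScale u := Real.sqrt_nonneg _

lemma lilScale_mono {u v : ℝ} (hu : Real.exp 1 ≤ u) (huv : u ≤ v) : lilScale u ≤ lilScale v := by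
  have hu0 : 0 < u := (Real.exp_pos 1).trans_le hu
  have h1 : 1 ≤ Real.log u := (Real.le_log_iff_exp_le hu0).2 hu
  have h2 : 0 ≤ Real.log (Real.log u) := Real.log_nonneg h1
  have h3 : Real.log u ≤ Real.log v := Real.log_le_log hu0 huv
  have hv0 : 0 < v := hu0.trans_le huv
  unfold lilScale
  gcongr

lemma mul_lilScale_le {q u : ℝ} (hq : 1 ≤ q) (hu : Real.exp 1 ≤ u) :
    √q * lilScale u ≤ lilScale (q * u) := by
  have hu0 : 0 < u := (Real.exp_pos 1).trans_le hu
  have h1 : 1 ≤ Real.log u := (Real.le_log_iff_exp_le hu0).2 hu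
  have h2 : 0 ≤ Real.log (Real.log u) := Real.log_nonneg h1
  have h3 : Real.log u ≤ Real.log (q * u) :=
    Real.log_le_log hu0 (le_mul_of_one_le_left hu0.le hq)
  unfold lilScale
  rw [← Real.sqrt_mul (by linarith)]
  refine Real.sqrt_le_sqrt ?_
  calc q * (2 * u * Real.log (Real.log u)) = 2 * (q * u) * Real.log (Real.log u) := by ring
    _ ≤ _ := by gcongr

namespace IsFilteredWiener

variable {P : Measure Ω} {G : ℝ → MeasurableSpace Ω} {W : ℝ → Ω → ℝ}

lemma eventually_le_mul_lilScale [IsProbabilityMeasure P] (h : IsFilteredWiener P G W)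
    {ε : ℝ} (hε : 0 < ε) :
    ∀ᵐ ω ∂P, ∀ᶠ u in atTop, W u ω ≤ (1 + ε) * lilScale u := by
  set q : ℝ := 1 + ε with hq
  have hq1 : 1 < q := by linarith
  have hlq : 0 < Real.log q := Real.log_pos hq1
  obtain ⟨N, hN⟩ := exists_nat_ge (1 / Real.log q)
  have hN1 : ∀ n : ℕ, 1 ≤ ((n + N : ℕ) : ℝ) * Real.log q := fun n => by
    rw [div_le_iff₀ hlq] at hN
    push_cast
    nlinarith [(Nat.cast_nonneg n : (0 : ℝ) ≤ n)]
  set V : ℕ → Set Ω := fun n => {ω | ∃ u ∈ Icc 0 (q ^ (n + N + 1)), q * lilScale (q ^ (n + N)) < W u ω}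
  have hV : ∀ n, P (V n) ≤
      ENNReal.ofReal (2 * (((n + N : ℕ) : ℝ) * Real.log q) ^ (-q)) := fun n => by
    refine (h.measure_exists_gt_le (by positivity)
      (mul_nonneg (by linarith) (lilScale_nonneg _))).trans ?_
    rw [show (2 : ℝ≥0∞) = ENNReal.ofReal 2 by simp, ← ENNReal.ofReal_mul (by norm_num)]
    refine ENNReal.ofReal_le_ofReal (mul_le_mul_of_nonneg_left (le_of_eq ?_) (by norm_num))
    have hpos : 0 < ((n + N : ℕ) : ℝ) * Real.log q := zero_lt_one.trans_le (hN1 n)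
    rw [Real.rpow_def_of_pos hpos, mul_pow, lilScale, Real.sq_sqrt, Real.log_pow]
    · congr 1
      field_simp
      ring
    · rw [Real.log_pow]
      have := Real.log_nonneg (hN1 n)
      positivity
  have hsum : ∑' n, P (V n) ≠ ⊤ := by
    refine ne_top_of_le_ne_top ?_ (ENNReal.tsum_le_tsum hV)
    refine Summable.tsum_ofReal_ne_top ?_
    have h1 : Summable fun n : ℕ => 2 * ((n : ℝ) ^ (-q) * Real.log q ^ (-q)) :=
      ((Real.summable_nat_rpow.2 (by linarith)).mul_right _).mul_left _
    have h2 := (summable_nat_add_iff N).2 h1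
    refine h2.congr fun n => ?_
    rw [Real.mul_rpow (Nat.cast_nonneg _) hlq.le]
  filter_upwards [ae_eventually_notMem hsum] with ω hω
  obtain ⟨M, hM⟩ := eventually_atTop.1 hω
  have hev : ∀ᶠ n : ℕ in atTop, Real.exp 1 ≤ q ^ n :=
    (tendsto_pow_atTop_atTop_of_one_lt hq1).eventually_ge_atTop _
  obtain ⟨K, hK⟩ := eventually_atTop.1 hev
  filter_upwards [eventually_ge_atTop (q ^ (M + N + K))] with u hu
  have hu1 : 1 ≤ u := (one_le_pow₀ hq1.le).trans hu
  obtain ⟨n, hn1, hn2⟩ := exists_nat_pow_near hu1 hq1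
  have hn : M + N + K < n + 1 := (pow_lt_pow_iff_right₀ hq1).1 (hu.trans_lt hn2)
  have h1 := hM (n - N) (by omega)
  have h2 : n - N + N = n := by omega
  simp only [V, mem_ofPred_eq, h2, not_exists, not_and, not_lt] at h1
  refine (h1 u ⟨by linarith, hn2.le⟩).trans ?_
  gcongr
  exact lilScale_mono (hK n (by omega)) hn1

lemma frequently_increment [IsProbabilityMeasure P] (h : IsFilteredWiener P G W)
    {ε q : ℝ} (hε : 0 < ε) (hε1 : ε < 1) (hq1 : 1 < q) :
    ∀ᵐ ω ∂P, ∃ᶠ n : ℕ in atTop, (1 - ε) * √(1 - 1 / q) * lilScale (q ^ (n + 1)) ≤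
      W (q ^ (n + 1)) ω - W (q ^ n) ω := by
  have hlq : 0 < Real.log q := Real.log_pos hq1
  have hq0 : 0 < q := by linarith
  have hqn : ∀ n : ℕ, q ^ n ≤ q ^ (n + 1) := fun n => pow_le_pow_right₀ hq1.le (Nat.le_succ n)
  have hvar : ∀ n : ℕ, q ^ (n + 1) - q ^ n = (1 - 1 / q) * q ^ (n + 1) := fun n => by
    rw [pow_succ]; field_simp
  have hq' : 0 < 1 - 1 / q := by
    rw [sub_pos, div_lt_one hq0]; exact hq1
  set S : ℕ → Set Ω := fun n => {ω | (1 - ε) * √(1 - 1 / q) * lilScale (q ^ (n + 1)) ≤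
      W (q ^ (n + 1)) ω - W (q ^ n) ω} with hSdef
  set F : ℕ → MeasurableSpace Ω := fun n => G (q ^ n)
  have hF : Monotone F := fun i j hij => h.mono (pow_le_pow_right₀ hq1.le hij)
  have hS : ∀ n, MeasurableSet[F (n + 1)] (S n) := fun n =>
    (((h.adapted _ (by positivity)).sub
      ((h.adapted _ (by positivity)).mono (h.mono (hqn n)) le_rfl)) measurableSet_Ici)
  have hind : iIndepSet S P := by
    refine iIndepSet_of_indep_filtration hF (fun n => h.le _) hS fun n A hA => ?_
    exact (Indep_iff _ _ _).1 (h.indep_sub (by positivity) (hqn n)) _ _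
      ⟨Ici _, measurableSet_Ici, rfl⟩ hA
  set L : ℕ → ℝ := fun n => Real.log (((n + 1 : ℕ) : ℝ) * Real.log q) with hL
  have hLtop : Tendsto L atTop atTop := by
    refine Real.tendsto_log_atTop.comp (Tendsto.atTop_mul_const hlq ?_)
    exact tendsto_natCast_atTop_atTop.comp (tendsto_add_atTop_nat 1)
  have hprob : ∀ᶠ n in atTop, (√(2 * Real.pi))⁻¹ * (Real.log q)⁻¹ * (((n + 1 : ℕ) : ℝ))⁻¹ ≤
      (P (S n)).toReal := by
    filter_upwards [hLtop.eventually_ge_atTop (1 / (2 * ε ^ 2))] with n hn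
    have hLn : 0 < L n := lt_of_lt_of_le (by positivity) hn
    set x : ℝ := (1 - ε) * √(2 * L n) with hx
    have hx0 : 0 ≤ x := mul_nonneg (by linarith) (Real.sqrt_nonneg _)
    have hmeas : Measurable fun ω => W (q ^ (n + 1)) ω - W (q ^ n) ω :=
      (h.measurable (by positivity)).sub (h.measurable (by positivity))
    have hPS : P (S n) = gaussianReal 0 (q ^ (n + 1) - q ^ n).toNNReal
        (Ici (x * √(q ^ (n + 1) - q ^ n))) := by
      rw [← h.map_sub (by positivity) (hqn n), Measure.map_apply hmeas measurableSet_Ici]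
      congr 1
      ext ω
      simp only [hSdef, mem_ofPred_eq, mem_preimage, mem_Ici]
      have : (1 - ε) * √(1 - 1 / q) * lilScale (q ^ (n + 1)) = x * √(q ^ (n + 1) - q ^ n) := by
        rw [hvar, hx, lilScale, Real.log_pow, mul_assoc, mul_assoc (1 - ε), ← Real.sqrt_mul hq'.le,
          ← Real.sqrt_mul (by positivity)]
        congr 2
        simp only [hL]
        ring
      rw [this]
    have hxL : (x + 1) ^ 2 / 2 ≤ L n := by
      have h1 : 1 ≤ ε * √(2 * L n) := by
        rw [← Real.sqrt_sq hε.le, ← Real.sqrt_mul (by positivity), Real.one_le_sqrt]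
        rw [div_le_iff₀ (by positivity)] at hn
        linarith
      have h2 : x + 1 ≤ √(2 * L n) := by rw [hx]; linarith
      have h3 := pow_le_pow_left₀ (by linarith) h2 2
      rw [Real.sq_sqrt (by positivity)] at h3
      linarith
    have hlow := le_gaussianReal_Ici (sub_pos.2 (pow_lt_pow_right₀ hq1 (Nat.lt_succ_self n))) hx0
    rw [← hPS, ENNReal.ofReal_le_iff_le_toReal (measure_ne_top _ _)] at hlow
    refine le_trans ?_ hlow
    rw [mul_assoc]
    refine mul_le_mul_of_nonneg_left ?_ (by positivity)
    have h4 : Real.exp (-L n) ≤ Real.exp (-(x + 1) ^ 2 / 2) := by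
      rw [Real.exp_le_exp, neg_div]
      linarith
    refine le_trans (le_of_eq ?_) h4
    rw [Real.exp_neg, hL, Real.exp_log (by positivity), mul_inv, mul_comm]
  have hsum : ∑' n, P (S n) = ⊤ := by
    by_contra hne
    have h1 := ENNReal.summable_toReal hne
    have h2 : Summable fun n : ℕ =>
        (√(2 * Real.pi))⁻¹ * (Real.log q)⁻¹ * (((n + 1 : ℕ) : ℝ))⁻¹ := by
      refine Summable.of_norm_bounded_eventually_nat h1 ?_
      filter_upwards [hprob] with n hn
      rwa [Real.norm_of_nonneg (by positivity)]
    rw [summable_mul_left_iff (by positivity)] at h2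
    have h3 := (summable_nat_add_iff (f := fun n : ℕ => ((n : ℝ))⁻¹) 1).1 h2
    exact Real.not_summable_natCast_inv h3
  have hSm : ∀ n, MeasurableSet (S n) := fun n => h.le _ _ (hS n)
  have hone := measure_limsup_eq_one hSm hind hsum
  have hae := (mem_ae_iff_prob_eq_one (MeasurableSet.measurableSet_limsup hSm)).2 hone
  filter_upwards [hae] with ω hω
  exact mem_limsup_iff_frequently_mem.1 hω

lemma frequently_mul_lilScale_le [IsProbabilityMeasure P] (h : IsFilteredWiener P G W)
    {ε : ℝ} (hε : 0 < ε) (hε1 : ε < 1) :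
    ∀ᵐ ω ∂P, ∃ᶠ u in atTop, (1 - ε) * lilScale u ≤ W u ω := by
  have hlim : Tendsto (fun q : ℝ => (1 - ε / 2) * √(1 - 1 / q) - 2 / √q) atTop
      (𝓝 ((1 - ε / 2) * √(1 - 0) - 0)) := by
    refine Tendsto.sub (Tendsto.const_mul _ ?_) ?_
    · refine (Real.continuous_sqrt.tendsto _).comp (tendsto_const_nhds.sub ?_)
      exact Tendsto.const_div_atTop tendsto_id 1
    · exact Tendsto.const_div_atTop Real.tendsto_sqrt_atTop _
  obtain ⟨q, hq, hq1⟩ := ((hlim.eventually_const_lt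
    (show 1 - ε < _ by simp; linarith)).and (eventually_gt_atTop 1)).exists
  have hq0 : 0 < q := by linarith
  have hpow : Tendsto (fun n : ℕ => q ^ n) atTop atTop := tendsto_pow_atTop_atTop_of_one_lt hq1
  filter_upwards [h.frequently_increment (half_pos hε) (by linarith) hq1,
    h.neg.eventually_le_mul_lilScale one_pos] with ω h1 h2
  have h3 : ∀ᶠ n : ℕ in atTop, -W (q ^ n) ω ≤ (1 + 1) * lilScale (q ^ n) ∧ Real.exp 1 ≤ q ^ n :=
    (hpow.eventually h2).and (hpow.eventually_ge_atTop _)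
  refine (hpow.comp (tendsto_add_atTop_nat 1)).frequently ((h1.and_eventually h3).mono ?_)
  rintro n ⟨hn1, hn2, hn3⟩
  have h4 := mul_lilScale_le hq1.le hn3
  rw [← pow_succ'] at h4
  have h5 : lilScale (q ^ n) ≤ lilScale (q ^ (n + 1)) / √q := by
    rw [le_div_iff₀ (Real.sqrt_pos.2 hq0)]
    linarith
  simp only [Function.comp_apply]
  have h6 := mul_le_mul_of_nonneg_right hq.le (lilScale_nonneg (q ^ (n + 1)))
  have h7 : ((1 - ε / 2) * √(1 - 1 / q) - 2 / √q) * lilScale (q ^ (n + 1)) =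
    (1 - ε / 2) * √(1 - 1 / q) * lilScale (q ^ (n + 1)) - 2 * (lilScale (q ^ (n + 1)) / √q) := by
    ring
  linarith

end IsFilteredWiener

/-- The `k`-th point of the partition of `[s, t]` into `n + 1` intervals of equal length. -/
def gridPoint (s t : ℝ) (n k : ℕ) : ℝ := s + (t - s) * (k / (n + 1))

section gridPoint

variable {s t : ℝ}

lemma gridPoint_zero (n : ℕ) : gridPoint s t n 0 = s := by simp [gridPoint]

lemma gridPoint_last (n : ℕ) : gridPoint s t n (n + 1) = t := by
  have : (n : ℝ) + 1 ≠ 0 := by positivity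
  simp [gridPoint, this]

lemma gridPoint_mono (hst : s ≤ t) (n : ℕ) : Monotone (gridPoint s t n) := by
  intro i j hij
  have : (i : ℝ) ≤ j := by exact_mod_cast hij
  have := sub_nonneg.2 hst
  unfold gridPoint
  gcongr

lemma gridPoint_mem (hst : s ≤ t) {n k : ℕ} (hk : k ≤ n + 1) : gridPoint s t n k ∈ Icc s t :=
  ⟨(gridPoint_zero n).symm.le.trans (gridPoint_mono hst n (Nat.zero_le k)),
    (gridPoint_mono hst n hk).trans (gridPoint_last n).le⟩

lemma gridPoint_succ_sub (n k : ℕ) :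
    gridPoint s t n (k + 1) - gridPoint s t n k = (t - s) / (n + 1) := by
  simp only [gridPoint]
  push_cast
  ring

lemma tendsto_sum_gridPoint (hst : s ≤ t) {g h : ℝ → ℝ} (hg : ContinuousOn g (Icc s t))
    (hh : ContinuousOn h (Icc s t)) {c : ℕ → ℕ → ℝ}
    (hc : ∀ n k, c n k ∈ Icc (gridPoint s t n k) (gridPoint s t n (k + 1))) :
    Tendsto (fun n => ∑ k ∈ Finset.range (n + 1),
      g (c n k) * ∫ r in gridPoint s t n k..gridPoint s t n (k + 1), h r) atTop
      (𝓝 (∫ r in s..t, g r * h r)) := by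
  obtain ⟨K, hK⟩ := isCompact_Icc.exists_bound_of_continuousOn hh
  set K' : ℝ := |K| + 1
  have hK' : ∀ r ∈ Icc s t, |h r| ≤ K' := fun r hr =>
    (hK r hr).trans ((le_abs_self K).trans (by simp [K']))
  have hK0 : 0 < K' := by positivity
  have huc := isCompact_Icc.uniformContinuousOn_of_continuous hg
  rw [Metric.uniformContinuousOn_iff] at huc
  rw [Metric.tendsto_atTop]
  intro ε hε
  have hts := sub_nonneg.2 hst
  obtain ⟨δ, hδ, hgδ⟩ := huc (ε / (K' * (t - s + 1))) (by positivity)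
  obtain ⟨N, hN⟩ := exists_nat_gt ((t - s) / δ)
  refine ⟨N, fun n hn => ?_⟩
  have hmesh : (t - s) / (n + 1) < δ := by
    rw [div_lt_comm₀ (by positivity) hδ]
    have : (N : ℝ) ≤ n := by exact_mod_cast hn
    linarith
  have hsub : ∀ k ∈ Finset.range (n + 1),
      Icc (gridPoint s t n k) (gridPoint s t n (k + 1)) ⊆ Icc s t := fun k hk => by
    have := Finset.mem_range.1 hk
    exact Icc_subset_Icc (gridPoint_mem hst (by omega)).1 (gridPoint_mem hst (by omega)).2
  have hle : ∀ k, gridPoint s t n k ≤ gridPoint s t n (k + 1) := fun k =>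
    gridPoint_mono hst n (Nat.le_succ k)
  have hintgh : ∀ k ∈ Finset.range (n + 1), IntervalIntegrable (fun r => g r * h r) volume
      (gridPoint s t n k) (gridPoint s t n (k + 1)) := fun k hk => by
    refine ContinuousOn.intervalIntegrable ?_
    rw [uIcc_of_le (hle k)]
    exact (hg.mul hh).mono (hsub k hk)
  have hinth : ∀ k ∈ Finset.range (n + 1), IntervalIntegrable h volume
      (gridPoint s t n k) (gridPoint s t n (k + 1)) := fun k hk => by
    refine ContinuousOn.intervalIntegrable ?_
    rw [uIcc_of_le (hle k)]
    exact hh.mono (hsub k hk)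
  have hsplit : ∫ r in s..t, g r * h r = ∑ k ∈ Finset.range (n + 1),
      ∫ r in gridPoint s t n k..gridPoint s t n (k + 1), g r * h r := by
    rw [intervalIntegral.sum_integral_adjacent_intervals
      (fun k hk => hintgh k (Finset.mem_range.2 hk)), gridPoint_zero, gridPoint_last]
  rw [Real.dist_eq, hsplit, ← Finset.sum_sub_distrib]
  have hterm : ∀ k ∈ Finset.range (n + 1),
      |g (c n k) * (∫ r in gridPoint s t n k..gridPoint s t n (k + 1), h r) -
        ∫ r in gridPoint s t n k..gridPoint s t n (k + 1), g r * h r| ≤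
      (ε / (K' * (t - s + 1)) * K') * ((t - s) / (n + 1)) := fun k hk => by
    rw [← intervalIntegral.integral_const_mul,
      ← intervalIntegral.integral_sub ((hinth k hk).const_mul _) (hintgh k hk),
      ← gridPoint_succ_sub n k, ← abs_of_nonneg (sub_nonneg.2 (hle k))]
    refine (Real.norm_eq_abs _).symm.le.trans
      (intervalIntegral.norm_integral_le_of_norm_le_const fun r hr => ?_)
    rw [uIoc_of_le (hle k)] at hr
    have hr' : r ∈ Icc (gridPoint s t n k) (gridPoint s t n (k + 1)) := Ioc_subset_Icc_self hr
    rw [← sub_mul, norm_mul]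
    refine mul_le_mul ?_ (hK' r (hsub k hk hr')) (norm_nonneg _) (by positivity)
    refine (hgδ _ (hsub k hk (hc n k)) _ (hsub k hk hr') ?_).le
    refine (abs_sub_le_iff.2 ⟨?_, ?_⟩).trans_lt (hmesh.trans_eq' (gridPoint_succ_sub n k).symm) <;>
      linarith [(hc n k).1, (hc n k).2, hr'.1, hr'.2]
  refine (Finset.abs_sum_le_sum_abs _ _).trans_lt ((Finset.sum_le_sum hterm).trans_lt ?_)
  rw [Finset.sum_const, Finset.card_range, nsmul_eq_mul]
  push_cast
  have e : (n + 1 : ℝ) * (ε / (K' * (t - s + 1)) * K' * ((t - s) / (n + 1))) =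
      ε * ((t - s) / (t - s + 1)) := by
    field_simp
  rw [e]
  refine mul_lt_of_lt_one_right hε ?_
  rw [div_lt_one (by positivity)]
  linarith

end gridPoint

/-- The `σ`-algebra generated by `B` on the time interval `[0, t]`. -/
abbrev pastSigma (B : ℝ → Ω → ℝ) (t : ℝ) : MeasurableSpace Ω :=
  ⨆ s ∈ Icc (0 : ℝ) t, MeasurableSpace.comap (B s) inferInstance

lemma pastSigma_mono {E : Type*} (B : ℝ → E → ℝ) : Monotone (pastSigma B) := fun _ _ h =>
  biSup_mono fun _ hr => ⟨hr.1, hr.2.trans h⟩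

lemma pastSigma_le {B : ℝ → Ω → ℝ} (hB : ∀ t, Measurable (B t)) (t : ℝ) :
    pastSigma B t ≤ ‹MeasurableSpace Ω› :=
  iSup₂_le fun r _ => (hB r).comap_le

lemma measurable_pastSigma {E : Type*} (B : ℝ → E → ℝ) {s t : ℝ} (hs : 0 ≤ s) (hst : s ≤ t) :
    Measurable[pastSigma B t] (B s) :=
  measurable_iff_comap_le.2 (le_iSup₂_of_le s ⟨hs, hst⟩ le_rfl)

lemma IsStandardWiener.isGaussianStep {P : Measure Ω} {B : ℝ → Ω → ℝ}
    (hB : IsStandardWiener P B) {s t : ℝ} (hs : 0 ≤ s) (hst : s ≤ t) :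
    IsGaussianStep P (pastSigma B s) (fun ω => B t ω - B s ω) (t - s) := by
  refine IsGaussianStep.of_indep ((hB.meas t).sub (hB.meas s)) (sub_nonneg.2 hst) ?_
    (hB.incr_law s t hs hst)
  have h := hB.incr_indep s t hs hst
  rw [IndepFun_iff_Indep] at h
  refine indep_of_indep_of_le_right h (iSup₂_le fun r hr => ?_)
  rintro _ ⟨S, hS, rfl⟩
  exact ⟨(fun x : Icc (0 : ℝ) s → ℝ => x ⟨r, hr⟩) ⁻¹' S, measurable_pi_apply _ hS, rfl⟩

section Bridge

variable {P : Measure Ω} {T : ℝ} {B : ℝ → Ω → ℝ}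

lemma hasDerivAt_rpow_neg_half {r : ℝ} (hr : r < T) :
    HasDerivAt (fun r => (T - r) ^ (-(1 / 2) : ℝ)) (1 / 2 * (T - r) ^ (-(1 / 2) - 1 : ℝ)) r := by
  have := ((hasDerivAt_id r).const_sub T).rpow_const (p := -(1 / 2))
    (Or.inl (sub_pos.2 hr).ne')
  refine this.congr_deriv ?_
  simp only [id_eq]
  ring

lemma continuousOn_sub_rpow {s t : ℝ} (ht : t < T) (p : ℝ) :
    ContinuousOn (fun r => (T - r) ^ p) (Icc s t) :=
  ContinuousOn.rpow_const (by fun_prop) fun r hr => Or.inl (by linarith [hr.2])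

/-- The `1/2`-Wiener bridge divided by `√(T - t)`, that is `∫₀ᵗ (T - s)^{-1/2} dB_s`. -/
def bridgeMartingale (T : ℝ) (B : ℝ → Ω → ℝ) (t : ℝ) (ω : Ω) : ℝ :=
  alphaWienerBridge T (1 / 2) B t ω / √(T - t)

lemma bridgeMartingale_eq {E : Type*} {B : ℝ → E → ℝ} {t : ℝ} (ht : t < T) (ω : E) :
    bridgeMartingale T B t ω = (T - t) ^ (-(1 / 2) : ℝ) * B t ω -
      ∫ s in Ioc (0 : ℝ) t, B s ω * (1 / 2 * (T - s) ^ (-(1 / 2) - 1 : ℝ)) := by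
  have hT : 0 < T - t := sub_pos.2 ht
  have h1 : ∫ s in Ioc (0 : ℝ) t, B s ω * (1 / 2 * (T - s) ^ (-(1 / 2) - 1 : ℝ)) =
      1 / 2 * ∫ s in Ioc (0 : ℝ) t, (T - s) ^ (-(1 / 2) - 1 : ℝ) * B s ω := by
    rw [← integral_const_mul]
    congr 1
    ext s
    ring
  have h2 : √(T - t) ≠ 0 := (Real.sqrt_pos.2 hT).ne'
  rw [h1, bridgeMartingale, alphaWienerBridge, Real.rpow_neg hT.le, ← Real.sqrt_eq_rpow]
  field_simp

/-- The approximation of the Wiener integral `∫ₛᵗ (T - r)^{-1/2} dB_r` on a finite grid. -/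
def bridgeSum (T : ℝ) (B : ℝ → Ω → ℝ) (s t : ℝ) (n : ℕ) (ω : Ω) : ℝ :=
  ∑ k ∈ Finset.range (n + 1), (T - gridPoint s t n (k + 1)) ^ (-(1 / 2) : ℝ) *
    (B (gridPoint s t n (k + 1)) ω - B (gridPoint s t n k) ω)

lemma tendsto_bridgeSum {E : Type*} {B : ℝ → E → ℝ} {s t : ℝ} (hs : 0 ≤ s) (hst : s ≤ t) (ht : t < T) {ω : E}
    (hcont : Continuous fun t => B t ω) :
    Tendsto (fun n => bridgeSum T B s t n ω) atTop
      (𝓝 (bridgeMartingale T B t ω - bridgeMartingale T B s ω)) := by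
  have hderiv : ContinuousOn (fun r => 1 / 2 * (T - r) ^ (-(1 / 2) - 1 : ℝ)) (Icc 0 t) :=
    continuousOn_const.mul (continuousOn_sub_rpow ht _)
  have hintegrable : ∀ a b, 0 ≤ a → a ≤ b → b ≤ t → IntervalIntegrable
      (fun r => 1 / 2 * (T - r) ^ (-(1 / 2) - 1 : ℝ)) volume a b := fun a b ha hab hb => by
    refine ContinuousOn.intervalIntegrable ?_
    rw [uIcc_of_le hab]
    exact hderiv.mono (Icc_subset_Icc ha hb)
  have hintB : ∀ a b, 0 ≤ a → a ≤ b → b ≤ t → IntervalIntegrable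
      (fun r => B r ω * (1 / 2 * (T - r) ^ (-(1 / 2) - 1 : ℝ))) volume a b :=
    fun a b ha hab hb => (hintegrable a b ha hab hb).continuousOn_mul hcont.continuousOn
  have hlim := tendsto_sum_gridPoint hst (g := fun r => B r ω) hcont.continuousOn
    (hderiv.mono (Icc_subset_Icc_left hs)) (c := fun n k => gridPoint s t n k)
    (fun n k => ⟨le_rfl, gridPoint_mono hst n (Nat.le_succ k)⟩)
  have heq : ∀ n, bridgeSum T B s t n ω =
      (T - t) ^ (-(1 / 2) : ℝ) * B t ω - (T - s) ^ (-(1 / 2) : ℝ) * B s ω -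
      ∑ k ∈ Finset.range (n + 1), B (gridPoint s t n k) ω *
        ∫ r in gridPoint s t n k..gridPoint s t n (k + 1),
          1 / 2 * (T - r) ^ (-(1 / 2) - 1 : ℝ) := fun n => by
    have h1 : ∀ k ∈ Finset.range (n + 1), ∫ r in gridPoint s t n k..gridPoint s t n (k + 1),
        1 / 2 * (T - r) ^ (-(1 / 2) - 1 : ℝ) = (T - gridPoint s t n (k + 1)) ^ (-(1 / 2) : ℝ) -
          (T - gridPoint s t n k) ^ (-(1 / 2) : ℝ) := fun k hk => by
      have hk' := Finset.mem_range.1 hk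
      have hle := gridPoint_mono hst n (Nat.le_succ k)
      have ha := (gridPoint_mem hst (n := n) (k := k) (by omega)).1
      have hb := (gridPoint_mem hst (n := n) (k := k + 1) (by omega)).2
      refine intervalIntegral.integral_eq_sub_of_hasDerivAt
        (f := fun r => (T - r) ^ (-(1 / 2) : ℝ)) (fun r hr => ?_) (hintegrable _ _ (hs.trans ha) hle hb)
      rw [uIcc_of_le hle] at hr
      exact hasDerivAt_rpow_neg_half ((hr.2.trans hb).trans_lt ht)
    have h2 := Finset.sum_range_sub
      (fun k => (T - gridPoint s t n k) ^ (-(1 / 2) : ℝ) * B (gridPoint s t n k) ω) (n + 1)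
    simp only [gridPoint_zero, gridPoint_last] at h2
    rw [← h2, bridgeSum, ← Finset.sum_sub_distrib]
    refine Finset.sum_congr rfl fun k hk => ?_
    rw [h1 k hk]
    ring
  simp_rw [heq]
  have hval : bridgeMartingale T B t ω - bridgeMartingale T B s ω =
      (T - t) ^ (-(1 / 2) : ℝ) * B t ω - (T - s) ^ (-(1 / 2) : ℝ) * B s ω -
        ∫ r in s..t, B r ω * (1 / 2 * (T - r) ^ (-(1 / 2) - 1 : ℝ)) := by
    rw [bridgeMartingale_eq ht, bridgeMartingale_eq (hst.trans_lt ht),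
      ← intervalIntegral.integral_of_le (hs.trans hst), ← intervalIntegral.integral_of_le hs,
      ← intervalIntegral.integral_add_adjacent_intervals (hintB 0 s le_rfl hs hst)
        (hintB s t hs hst le_rfl)]
    ring
  rw [hval]
  exact hlim.const_sub _

lemma measurable_bridgeSum {E : Type*} {B : ℝ → E → ℝ} {s t : ℝ} (hs : 0 ≤ s) (hst : s ≤ t) (n : ℕ) :
    Measurable[pastSigma B t] (bridgeSum T B s t n) := by
  refine Finset.measurable_sum _ fun k hk => ?_
  have hk' := Finset.mem_range.1 hk
  have ha := gridPoint_mem hst (n := n) (k := k) (by omega)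
  have hb := gridPoint_mem hst (n := n) (k := k + 1) (by omega)
  exact ((measurable_pastSigma B (hs.trans hb.1) hb.2).sub
    (measurable_pastSigma B (hs.trans ha.1) ha.2)).const_mul _

lemma IsStandardWiener.isGaussianStep_bridgeMartingale [IsProbabilityMeasure P]
    (hB : IsStandardWiener P B) (hcont : ∀ ω, Continuous fun t => B t ω) {s t : ℝ}
    (hs : 0 ≤ s) (hst : s ≤ t) (ht : t < T) :
    IsGaussianStep P (pastSigma B s)
      (fun ω => bridgeMartingale T B t ω - bridgeMartingale T B s ω)
      (Real.log (T - s) - Real.log (T - t)) := by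
  refine IsGaussianStep.of_tendsto
    (z := fun n => ∑ k ∈ Finset.range (n + 1), ((T - gridPoint s t n (k + 1)) ^ (-(1 / 2) : ℝ)) ^ 2 *
      (gridPoint s t n (k + 1) - gridPoint s t n k))
    (fun n => (measurable_bridgeSum hs hst n).mono (pastSigma_le hB.meas t) le_rfl) (fun n => ?_)
    (fun ω => tendsto_bridgeSum hs hst ht (hcont ω)) ?_
  · have hmono := gridPoint_mono hst n
    have h0 : ∀ k, 0 ≤ gridPoint s t n k := fun k =>
      hs.trans ((gridPoint_zero n).symm.le.trans (hmono (Nat.zero_le k)))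
    have := IsGaussianStep.sum (P := P) (F := fun k => pastSigma B (gridPoint s t n k))
      (Z := fun k ω => (T - gridPoint s t n (k + 1)) ^ (-(1 / 2) : ℝ) *
        (B (gridPoint s t n (k + 1)) ω - B (gridPoint s t n k) ω))
      (z := fun k => ((T - gridPoint s t n (k + 1)) ^ (-(1 / 2) : ℝ)) ^ 2 *
        (gridPoint s t n (k + 1) - gridPoint s t n k))
      (fun i j hij => pastSigma_mono B (hmono hij)) (fun k => pastSigma_le hB.meas _)
      (fun k => ((measurable_pastSigma B (h0 _) le_rfl).sub
        (measurable_pastSigma B (h0 _) (hmono (Nat.le_succ k)))).const_mul _)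
      (fun k => mul_nonneg (sq_nonneg _) (sub_nonneg.2 (hmono (Nat.le_succ k))))
      (fun k => (hB.isGaussianStep (h0 k) (hmono (Nat.le_succ k))).const_mul _) (n + 1)
    rw [gridPoint_zero] at this
    exact this
  · have hlim := tendsto_sum_gridPoint hst (g := fun r => ((T - r) ^ (-(1 / 2) : ℝ)) ^ 2)
      (h := fun _ => 1) ((continuousOn_sub_rpow ht _).pow 2) continuousOn_const
      (c := fun n k => gridPoint s t n (k + 1))
      (fun n k => ⟨gridPoint_mono hst n (Nat.le_succ k), le_rfl⟩)
    simp only [intervalIntegral.integral_const, smul_eq_mul, mul_one] at hlim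
    convert hlim using 2
    have hpos : ∀ r ∈ Icc s t, 0 < T - r := fun r hr => by linarith [hr.2]
    have hderiv : ∀ r ∈ uIcc s t,
        HasDerivAt (fun r => -Real.log (T - r)) (((T - r) ^ (-(1 / 2) : ℝ)) ^ 2) r := fun r hr => by
      rw [uIcc_of_le hst] at hr
      have := (((hasDerivAt_id r).const_sub T).log (hpos r hr).ne').neg
      refine this.congr_deriv ?_
      rw [← Real.rpow_natCast, ← Real.rpow_mul (hpos r hr).le]
      norm_num [Real.rpow_neg_one]
      rw [neg_div, neg_neg, one_div]
    rw [intervalIntegral.integral_eq_sub_of_hasDerivAt hderiv]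
    · ring
    · refine ContinuousOn.intervalIntegrable ?_
      rw [uIcc_of_le hst]
      exact (continuousOn_sub_rpow ht _).pow 2

lemma bridgeMartingale_zero {E : Type*} {B : ℝ → E → ℝ} {ω : E} (h0 : B 0 ω = 0) : bridgeMartingale T B 0 ω = 0 := by
  simp [bridgeMartingale, alphaWienerBridge, h0]

lemma measurable_bridgeMartingale {E : Type*} {B : ℝ → E → ℝ} (hcont : ∀ ω, Continuous fun t => B t ω)
    (h0 : ∀ ω, B 0 ω = 0) {t : ℝ} (ht0 : 0 ≤ t) (ht : t < T) :
    Measurable[pastSigma B t] (bridgeMartingale T B t) := by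
  refine @measurable_of_tendsto_metrizable _ _ (pastSigma B t) _ _ _ _ _ _
    (fun n => measurable_bridgeSum (T := T) le_rfl ht0 n) (tendsto_pi_nhds.2 fun ω => ?_)
  have := tendsto_bridgeSum le_rfl ht0 ht (hcont ω)
  rwa [bridgeMartingale_zero (h0 ω), sub_zero] at this

lemma continuousOn_bridgeMartingale {E : Type*} {B : ℝ → E → ℝ} {ω : E}
    (hcont : Continuous fun t => B t ω) :
    ContinuousOn (fun t => bridgeMartingale T B t ω) (Ico 0 T) := by
  intro t ht
  obtain ⟨b, htb, hbT⟩ := exists_between ht.2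
  have hintegrable : IntegrableOn (fun s => B s ω * (1 / 2 * (T - s) ^ (-(1 / 2) - 1 : ℝ))) (Icc 0 b) :=
    (hcont.continuousOn.mul (continuousOn_const.mul (continuousOn_sub_rpow hbT _))).integrableOn_Icc
  have h1 : ContinuousOn (fun t => bridgeMartingale T B t ω) (Icc 0 b) := by
    refine ((((continuousOn_sub_rpow hbT (-(1 / 2))).mul hcont.continuousOn).sub
      (intervalIntegral.continuousOn_primitive hintegrable))).congr fun r hr => ?_
    exact bridgeMartingale_eq (hr.2.trans_lt hbT) ω
  refine (h1 t ⟨ht.1, htb.le⟩).mono_of_mem_nhdsWithin ?_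
  filter_upwards [self_mem_nhdsWithin, mem_nhdsWithin_of_mem_nhds (Iio_mem_nhds htb)] with r h2 h3
  exact ⟨h2.1, le_of_lt h3⟩

/-- The time change `u ↦ T (1 - e^{-u})` from `[0, ∞)` onto `[0, T)`. -/
def bridgeTime (T u : ℝ) : ℝ := T * (1 - Real.exp (-u))

lemma sub_bridgeTime (u : ℝ) : T - bridgeTime T u = T * Real.exp (-u) := by
  unfold bridgeTime
  ring

lemma bridgeTime_mono (hT : 0 < T) : Monotone (bridgeTime T) := fun u v huv => by
  unfold bridgeTime
  gcongr

lemma bridgeTime_nonneg (hT : 0 < T) {u : ℝ} (hu : 0 ≤ u) : 0 ≤ bridgeTime T u := by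
  have := bridgeTime_mono hT hu
  simpa [bridgeTime] using this

lemma bridgeTime_lt (hT : 0 < T) (u : ℝ) : bridgeTime T u < T := by
  rw [← sub_pos, sub_bridgeTime]
  positivity

lemma IsStandardWiener.isFilteredWiener_bridgeMartingale [IsProbabilityMeasure P]
    (hB : IsStandardWiener P B) (hcont : ∀ ω, Continuous fun t => B t ω) (h0 : ∀ ω, B 0 ω = 0)
    (hT : 0 < T) :
    IsFilteredWiener P (fun u => pastSigma B (bridgeTime T u))
      (fun u => bridgeMartingale T B (bridgeTime T u)) where
  le u := pastSigma_le hB.meas _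
  mono := (pastSigma_mono B).comp (bridgeTime_mono hT)
  adapted u hu := measurable_bridgeMartingale hcont h0 (bridgeTime_nonneg hT hu) (bridgeTime_lt hT u)
  step u v hu huv := by
    convert hB.isGaussianStep_bridgeMartingale hcont (bridgeTime_nonneg hT hu)
      (bridgeTime_mono hT huv) (bridgeTime_lt hT v) using 1
    rw [sub_bridgeTime, sub_bridgeTime, Real.log_mul hT.ne' (Real.exp_ne_zero _),
      Real.log_mul hT.ne' (Real.exp_ne_zero _), Real.log_exp, Real.log_exp]
    ring
  init ω := by
    have : bridgeTime T 0 = 0 := by simp [bridgeTime]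
    simp only [this, bridgeMartingale_zero (h0 ω)]
  cont ω := by
    refine (continuousOn_bridgeMartingale (T := T) (hcont ω)).comp ?_
      fun u hu => ⟨bridgeTime_nonneg hT hu, bridgeTime_lt hT u⟩
    unfold bridgeTime
    fun_prop

end Bridge

lemma tendsto_lilScale_atTop : Tendsto lilScale atTop atTop := by
  refine Real.tendsto_sqrt_atTop.comp ?_
  exact (tendsto_id.const_mul_atTop two_pos).atTop_mul_atTop₀
    (Real.tendsto_log_atTop.comp Real.tendsto_log_atTop)

lemma tendsto_lilScale_add_div (c : ℝ) :
    Tendsto (fun u => lilScale (u + c) / lilScale u) atTop (𝓝 1) := by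
  have hl : Tendsto (fun u => Real.log u) atTop atTop := Real.tendsto_log_atTop
  have hll : Tendsto (fun u => Real.log (Real.log u)) atTop atTop := hl.comp hl
  have e1 : Asymptotics.IsEquivalent atTop (fun u : ℝ => u + c) (fun u => u) :=
    Asymptotics.IsEquivalent.refl.add_const_of_norm_tendsto_atTop tendsto_norm_atTop_atTop
  have e2 : Asymptotics.IsEquivalent atTop (fun u : ℝ => Real.log (Real.log (u + c)))
      (fun u => Real.log (Real.log u)) := (e1.log tendsto_id).log hl
  have e3 : Asymptotics.IsEquivalent atTop (fun u : ℝ => 2 * (u + c) * Real.log (Real.log (u + c)))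
      (fun u => 2 * u * Real.log (Real.log u)) :=
    (Asymptotics.IsEquivalent.refl.mul e1).mul e2
  have hpos : ∀ᶠ u : ℝ in atTop, 0 < 2 * u * Real.log (Real.log u) := by
    filter_upwards [eventually_gt_atTop 0, hll.eventually_gt_atTop 0] with u h1 h2
    positivity
  have h := (Asymptotics.isEquivalent_iff_tendsto_one (hpos.mono fun u h => h.ne')).1 e3
  have h' := (Real.continuous_sqrt.tendsto 1).comp h
  rw [Real.sqrt_one] at h'
  refine h'.congr' ?_
  filter_upwards [hpos] with u hu
  simp only [Function.comp_apply, Pi.div_apply, lilScale]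
  rw [Real.sqrt_div' _ hu.le]

lemma limsup_div_eq_one {ι : Type*} {l : Filter ι} [l.NeBot] {f s r : ι → ℝ}
    (hs : Tendsto s l atTop) (hr : Tendsto (fun i => s i / r i) l (𝓝 1))
    (hup : ∀ ε : ℝ, 0 < ε → ∀ᶠ i in l, f i ≤ (1 + ε) * s i)
    (hlow : ∀ ε : ℝ, 0 < ε → ε < 1 → ∃ᶠ i in l, (1 - ε) * s i ≤ f i) :
    limsup (fun i => ((f i / r i : ℝ) : EReal)) l = 1 := by
  have hr0 : ∀ᶠ i in l, 0 < r i := by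
    filter_upwards [hs.eventually_gt_atTop 0, hr.eventually_const_lt one_pos] with i h1 h2
    exact (div_pos_iff_of_pos_left h1).1 h2
  refine le_antisymm ?_ ?_
  · refine EReal.le_of_forall_lt_iff_le.1 fun z hz => ?_
    have hz1 : 1 < z := by exact_mod_cast hz
    have h2 : Tendsto (fun i => (1 + (z - 1) / 2) * (s i / r i)) l (𝓝 ((1 + (z - 1) / 2) * 1)) :=
      hr.const_mul _
    refine limsup_le_of_le (by isBoundedDefault) ?_
    filter_upwards [hup ((z - 1) / 2) (by linarith), hr0,
      h2.eventually_lt_const (show (1 + (z - 1) / 2) * 1 < z by linarith)] with i h3 h4 h5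
    refine EReal.coe_le_coe_iff.2 (le_trans ?_ h5.le)
    rw [← mul_div_assoc]
    gcongr
  · refine EReal.ge_of_forall_gt_iff_ge.1 fun z hz => ?_
    have hz1 : z < 1 := by exact_mod_cast hz
    obtain ⟨y, hy0, hy1⟩ := exists_between (max_lt hz1 one_pos)
    have h2 : Tendsto (fun i => y * (s i / r i)) l (𝓝 (y * 1)) := hr.const_mul _
    refine le_limsup_of_frequently_le ?_ (by isBoundedDefault)
    refine ((hlow (1 - y) (by linarith) (by linarith [le_max_right z 0])).and_eventually (hr0.and
      (h2.eventually_const_lt (show z < y * 1 by linarith [le_max_left z 0])))).mono ?_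
    rintro i ⟨h3, h4, h5⟩
    refine EReal.coe_le_coe_iff.2 (h5.le.trans ?_)
    rw [← mul_div_assoc]
    rw [sub_sub_cancel] at h3
    gcongr

lemma limsup_coe_eq_top {ι : Type*} {l : Filter ι} {f s : ι → ℝ} (hs : Tendsto s l atTop)
    (hlow : ∀ ε : ℝ, 0 < ε → ε < 1 → ∃ᶠ i in l, (1 - ε) * s i ≤ f i) :
    limsup (fun i => (f i : EReal)) l = ⊤ := by
  refine EReal.eq_top_iff_forall_lt _ |>.2 fun y => ?_
  refine (EReal.coe_lt_coe_iff.2 (lt_add_one y)).trans_le ?_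
  refine le_limsup_of_frequently_le ?_ (by isBoundedDefault)
  refine ((hlow (1 / 2) (by norm_num) (by norm_num)).and_eventually
    (hs.eventually_ge_atTop (2 * (y + 1)))).mono fun i hi => EReal.coe_le_coe_iff.2 ?_
  linarith [hi.1, hi.2]

lemma tendsto_log_inv_sub (T : ℝ) : Tendsto (fun t => Real.log (1 / (T - t))) (𝓝[<] T) atTop := by
  refine Real.tendsto_log_atTop.comp ?_
  simp only [one_div]
  refine tendsto_inv_nhdsGT_zero.comp (tendsto_nhdsWithin_iff.2 ⟨?_, ?_⟩)
  · have : Tendsto (fun t => T - t) (𝓝 T) (𝓝 (T - T)) := tendsto_const_nhds.sub tendsto_id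
    rw [sub_self] at this
    exact this.mono_left nhdsWithin_le_nhds
  · filter_upwards [self_mem_nhdsWithin] with t (ht : t < T) using sub_pos.2 ht

lemma bridgeTime_log {T t : ℝ} (hT : 0 < T) (ht : t < T) :
    bridgeTime T (Real.log (1 / (T - t)) + Real.log T) = t := by
  have h : 0 < T - t := sub_pos.2 ht
  rw [bridgeTime, ← Real.log_mul (one_div_pos.2 h).ne' hT.ne', ← Real.log_inv, Real.exp_log]
  · field_simp
    ring
  · positivity

lemma log_bridgeTime {T : ℝ} (hT : 0 < T) (u : ℝ) :
    Real.log (1 / (T - bridgeTime T u)) + Real.log T = u := by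
  rw [sub_bridgeTime, one_div, Real.log_inv, Real.log_mul hT.ne' (Real.exp_ne_zero _), Real.log_exp]
  ring

lemma tendsto_bridgeTime {T : ℝ} (hT : 0 < T) : Tendsto (bridgeTime T) atTop (𝓝[<] T) := by
  refine tendsto_nhdsWithin_iff.2 ⟨?_, Eventually.of_forall fun u => bridgeTime_lt hT u⟩
  have : Tendsto (fun u => T * (1 - Real.exp (-u))) atTop (𝓝 (T * (1 - 0))) :=
    (tendsto_const_nhds.sub Real.tendsto_exp_neg_atTop_nhds_zero).const_mul T
  rwa [sub_zero, mul_one] at this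

lemma bridge_div_eq {E : Type*} (T : ℝ) (B : ℝ → E → ℝ) (t : ℝ) (ω : E) (ht : t < T) :
    alphaWienerBridge T (1 / 2) B t ω /
      √(2 * (T - t) * Real.log (1 / (T - t)) * Real.log (Real.log (Real.log (1 / (T - t))))) =
    bridgeMartingale T B t ω / lilScale (Real.log (1 / (T - t))) := by
  rw [bridgeMartingale, lilScale, div_div, ← Real.sqrt_mul (sub_pos.2 ht).le]
  congr 2
  ring

/-- The two bounds at `T` that make up the upper half of the law of the iterated logarithm for `f`,
when time is measured by `u = ln (T / (T - t))`. -/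
def LilBounds (T : ℝ) (f : ℝ → ℝ) : Prop :=
  (∀ ε : ℝ, 0 < ε →
    ∀ᶠ t in 𝓝[<] T, f t ≤ (1 + ε) * lilScale (Real.log (1 / (T - t)) + Real.log T)) ∧
  (∀ ε : ℝ, 0 < ε → ε < 1 →
    ∃ᶠ t in 𝓝[<] T, (1 - ε) * lilScale (Real.log (1 / (T - t)) + Real.log T) ≤ f t)

lemma IsFilteredWiener.ae_lilBounds {P : Measure Ω} [IsProbabilityMeasure P]
    {G : ℝ → MeasurableSpace Ω} {T : ℝ} (hT : 0 < T) {Y : ℝ → Ω → ℝ}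
    (h : IsFilteredWiener P G fun u => Y (bridgeTime T u)) :
    ∀ᵐ ω ∂P, LilBounds T fun t => Y t ω := by
  have hlog := tendsto_atTop_add_const_right _ (Real.log T) (tendsto_log_inv_sub T)
  have h1 : ∀ᵐ ω ∂P, ∀ n : ℕ, ∀ᶠ u in atTop,
      Y (bridgeTime T u) ω ≤ (1 + 1 / ((n : ℝ) + 1)) * lilScale u :=
    ae_all_iff.2 fun n => h.eventually_le_mul_lilScale (by positivity)
  have h2 : ∀ᵐ ω ∂P, ∀ n : ℕ, ∃ᶠ u in atTop,
      (1 - 1 / (((n + 1 : ℕ) : ℝ) + 1)) * lilScale u ≤ Y (bridgeTime T u) ω := by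
    refine ae_all_iff.2 fun n => h.frequently_mul_lilScale_le (by positivity) ?_
    rw [div_lt_one (by positivity)]
    push_cast
    linarith [(n.cast_nonneg : (0 : ℝ) ≤ n)]
  filter_upwards [h1, h2] with ω hω1 hω2
  refine ⟨fun ε hε => ?_, fun ε hε _ => ?_⟩
  · obtain ⟨n, hn⟩ := exists_nat_one_div_lt hε
    filter_upwards [hlog.eventually (hω1 n), self_mem_nhdsWithin] with t h3 h4
    rw [bridgeTime_log hT h4] at h3
    refine h3.trans (mul_le_mul_of_nonneg_right ?_ (lilScale_nonneg _))
    linarith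
  · obtain ⟨n, hn⟩ := exists_nat_one_div_lt hε
    refine (tendsto_bridgeTime hT).frequently ((hω2 n).mono fun u hu => ?_)
    rw [log_bridgeTime hT]
    refine (mul_le_mul_of_nonneg_right ?_ (lilScale_nonneg _)).trans hu
    have : 1 / (((n + 1 : ℕ) : ℝ) + 1) ≤ 1 / ((n : ℝ) + 1) := by
      push_cast
      gcongr
      linarith
    linarith

lemma LilBounds.limsup_eq_one {T : ℝ} {f : ℝ → ℝ} (h : LilBounds T f) :
    limsup (fun t => ((f t / lilScale (Real.log (1 / (T - t))) : ℝ) : EReal)) (𝓝[<] T) = 1 :=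
  limsup_div_eq_one
    (tendsto_lilScale_atTop.comp
      (tendsto_atTop_add_const_right _ (Real.log T) (tendsto_log_inv_sub T)))
    ((tendsto_lilScale_add_div (Real.log T)).comp (tendsto_log_inv_sub T)) h.1 h.2

lemma LilBounds.limsup_eq_top {T : ℝ} {f : ℝ → ℝ} (h : LilBounds T f) :
    limsup (fun t => (f t : EReal)) (𝓝[<] T) = ⊤ :=
  limsup_coe_eq_top (tendsto_lilScale_atTop.comp
    (tendsto_atTop_add_const_right _ (Real.log T) (tendsto_log_inv_sub T))) h.2

lemma IsStandardWiener.congr {P : Measure Ω} {B B' : ℝ → Ω → ℝ} (hB : IsStandardWiener P B)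
    (hmeas : ∀ t, Measurable (B' t)) (h : ∀ᵐ ω ∂P, ∀ t, B t ω = B' t ω) :
    IsStandardWiener P B' where
  meas := hmeas
  init := by
    filter_upwards [hB.init, h] with ω h1 h2
    rw [← h2, h1]
  cont := by
    filter_upwards [hB.cont, h] with ω h1 h2
    simpa only [h2] using h1
  incr_indep s t hs hst := by
    refine (hB.incr_indep s t hs hst).congr ?_ ?_
    · filter_upwards [h] with ω hω
      simp only [hω]
    · filter_upwards [h] with ω hω
      simp only [hω]
  incr_law s t hs hst := by
    rw [← hB.incr_law s t hs hst]
    refine Measure.map_congr ?_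
    filter_upwards [h] with ω hω
    simp only [hω]

/-- Every standard Wiener process is indistinguishable from one all of whose paths are continuous
and start at `0`. -/
lemma IsStandardWiener.exists_continuous {P : Measure Ω} {B : ℝ → Ω → ℝ}
    (hB : IsStandardWiener P B) :
    ∃ B' : ℝ → Ω → ℝ, IsStandardWiener P B' ∧ (∀ ω, Continuous fun t => B' t ω) ∧
      (∀ ω, B' 0 ω = 0) ∧ ∀ᵐ ω ∂P, ∀ t, B t ω = B' t ω := by
  obtain ⟨N, hN, hNm, hN0⟩ :=
    exists_measurable_superset_of_null (ae_iff.1 (hB.init.and hB.cont))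
  have hgood : ∀ ω, ω ∉ N → B 0 ω = 0 ∧ Continuous fun t => B t ω := fun ω hω => by
    by_contra hc
    exact hω (hN hc)
  have h : ∀ᵐ ω ∂P, ∀ t, B t ω = Nᶜ.indicator (B t) ω := by
    have : ∀ᵐ ω ∂P, ω ∉ N := measure_eq_zero_iff_ae_notMem.1 hN0
    filter_upwards [this] with ω hω t
    rw [indicator_of_mem (mem_compl hω)]
  refine ⟨fun t => Nᶜ.indicator (B t), hB.congr (fun t => (hB.meas t).indicator hNm.compl) h,
    fun ω => ?_, fun ω => ?_, h⟩
  · by_cases hω : ω ∈ N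
    · simpa [hω] using continuous_const
    · simpa [hω] using (hgood ω hω).2
  · by_cases hω : ω ∈ N
    · simp [hω]
    · simpa [hω] using (hgood ω hω).1

lemma IsStandardWiener.ae_lilBounds {P : Measure Ω} [IsProbabilityMeasure P] {B : ℝ → Ω → ℝ}
    (hB : IsStandardWiener P B) {T : ℝ} (hT : 0 < T) :
    ∀ᵐ ω ∂P, LilBounds T (fun t => bridgeMartingale T B t ω) ∧
      LilBounds T (fun t => -bridgeMartingale T B t ω) := by
  obtain ⟨B', hB', hcont, h0, h⟩ := hB.exists_continuous
  have hW := hB'.isFilteredWiener_bridgeMartingale hcont h0 hT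
  filter_upwards [h, hW.ae_lilBounds hT,
    IsFilteredWiener.ae_lilBounds (Y := fun t ω => -bridgeMartingale T B' t ω) hT hW.neg]
    with ω h1 h2 h3
  simp only [bridgeMartingale, alphaWienerBridge, h1] at h2 h3 ⊢
  exact ⟨h2, h3⟩

/-- Law of the iterated logarithm for the `(1/2)`-Wiener bridge: a.s.
`limsup_{t↑T} X^{(1/2)}_t/√(2(T−t) ln(1/(T−t)) ln ln ln(1/(T−t))) = 1` and the corresponding
`liminf` is `−1`; in particular a.s. `limsup_{t↑T} X^{(1/2)}_t/√(T−t) = ∞` and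
`liminf_{t↑T} X^{(1/2)}_t/√(T−t) = −∞`. -/
theorem lil_alphaWienerBridge_half
    (P : Measure Ω) [IsProbabilityMeasure P]
    (T : ℝ) (hT : 0 < T) (B : ℝ → Ω → ℝ) (hB : IsStandardWiener P B) :
    (∀ᵐ ω ∂P, Filter.limsup (fun t =>
        ((alphaWienerBridge T (1/2) B t ω /
          Real.sqrt (2 * (T - t) * Real.log (1/(T - t)) *
            Real.log (Real.log (Real.log (1/(T - t))))) : ℝ) : EReal))
        (𝓝[<] T) = 1) ∧
    (∀ᵐ ω ∂P, Filter.liminf (fun t =>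
        ((alphaWienerBridge T (1/2) B t ω /
          Real.sqrt (2 * (T - t) * Real.log (1/(T - t)) *
            Real.log (Real.log (Real.log (1/(T - t))))) : ℝ) : EReal))
        (𝓝[<] T) = -1) ∧
    (∀ᵐ ω ∂P, Filter.limsup (fun t =>
        ((alphaWienerBridge T (1/2) B t ω / Real.sqrt (T - t) : ℝ) : EReal)) (𝓝[<] T) = ⊤) ∧
    (∀ᵐ ω ∂P, Filter.liminf (fun t =>
        ((alphaWienerBridge T (1/2) B t ω / Real.sqrt (T - t) : ℝ) : EReal)) (𝓝[<] T) = ⊥) := by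
  have h := hB.ae_lilBounds hT
  have hcongr : ∀ ω, (fun t =>
      ((alphaWienerBridge T (1/2) B t ω /
        Real.sqrt (2 * (T - t) * Real.log (1/(T - t)) *
          Real.log (Real.log (Real.log (1/(T - t))))) : ℝ) : EReal)) =ᶠ[𝓝[<] T]
      fun t => ((bridgeMartingale T B t ω / lilScale (Real.log (1 / (T - t))) : ℝ) : EReal) := by
    intro ω
    filter_upwards [self_mem_nhdsWithin] with t ht
    rw [bridge_div_eq T B t ω ht]
  refine ⟨?_, ?_, ?_, ?_⟩
  · filter_upwards [h] with ω hω
    rw [limsup_congr (hcongr ω), hω.1.limsup_eq_one]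
  · filter_upwards [h] with ω hω
    have hlim := hω.2.limsup_eq_one
    simp only [neg_div, EReal.coe_neg] at hlim
    rw [liminf_congr (hcongr ω), ← neg_neg (liminf _ _), ← EReal.limsup_neg]
    exact congrArg Neg.neg hlim
  · filter_upwards [h] with ω hω
    exact hω.1.limsup_eq_top
  · filter_upwards [h] with ω hω
    have hlim := hω.2.limsup_eq_top
    simp only [EReal.coe_neg] at hlim
    change liminf (fun t => (bridgeMartingale T B t ω : EReal)) (𝓝[<] T) = ⊥
    rw [← neg_neg (liminf _ _), ← EReal.limsup_neg, ← EReal.neg_top]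
    exact congrArg Neg.neg hlim
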